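/- As n → ∞, σmaex(n) ∼ σL(n), i.e., the ratio σmaex(n)/σL(n) tends to 1. -/

import Mathlib

open Finset

noncomputable section

/-- The largest part of a partition (`0` for the empty partition). -/
def largestPart {n : ℕ} (π : n.Partition) : ℕ := π.parts.sup

/-- The maximal excludant of a partition: the largest nonnegative integer smaller than
the largest part that is not a part. -/
def maex {n : ℕ} (π : n.Partition) : ℕ :=
  Nat.findGreatest (fun j => j ∉ π.parts) (largestPart π - 1)

/-- `σmaex n`, the sum of maximal excludants over all partitions of `n`. -/
def sigmaMaex (n : ℕ) : ℕ := ∑ π : n.Partition, maex π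

/-- `σL n`, the sum of largest parts over all partitions of `n`. -/
def sigmaL (n : ℕ) : ℕ := ∑ π : n.Partition, largestPart π

open Filter

theorem Multiset.sup_mem_of_ne_zero {s : Multiset ℕ} (hs : s ≠ 0) : s.sup ∈ s := by
  induction s using Multiset.induction_on with
  | empty => exact absurd rfl hs
  | cons a t ih =>
    rw [Multiset.sup_cons, Multiset.mem_cons]
    rcases le_total t.sup a with h | h
    · exact Or.inl (sup_eq_left.2 h)
    · rcases eq_or_ne t 0 with rfl | ht
      · left; simp
      · right; rw [sup_eq_right.2 h]; exact ih ht

theorem le_largestPart {n : ℕ} (π : n.Partition) {v : ℕ} (hv : v ∈ π.parts) :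
    v ≤ largestPart π :=
  Multiset.le_sup hv

theorem largestPart_mem {n : ℕ} (π : n.Partition) (h : largestPart π ≠ 0) :
    largestPart π ∈ π.parts := by
  refine Multiset.sup_mem_of_ne_zero fun h0 => h ?_
  simp [largestPart, h0]

/-- Replace the sub-multiset `m` of the parts of `π` by the single part `m.sum`
(and do nothing if this is impossible). -/
def mergeParts {n : ℕ} (π : n.Partition) (m : Multiset ℕ) : n.Partition :=
  if h : m ≤ π.parts ∧ 0 < m.sum then
    { parts := m.sum ::ₘ (π.parts - m)
      parts_pos := by
        intro i hi
        rcases Multiset.mem_cons.1 hi with rfl | hi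
        · exact h.2
        · exact π.parts_pos (Multiset.mem_of_le (Multiset.sub_le_self _ _) hi)
      parts_sum := by
        rw [Multiset.sum_cons, ← Multiset.sum_add, add_tsub_cancel_of_le h.1, π.parts_sum] }
  else π

theorem mergeParts_parts {n : ℕ} {π : n.Partition} {m : Multiset ℕ} (h : m ≤ π.parts)
    (hm : 0 < m.sum) : (mergeParts π m).parts = m.sum ::ₘ (π.parts - m) := by
  simp [mergeParts, h, hm]

/-- If the merged part is at least as large as all others, it is the largest part of the result. -/
theorem largestPart_mergeParts {n : ℕ} {π : n.Partition} {m : Multiset ℕ} (h : m ≤ π.parts)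
    (hm : 0 < m.sum) (hL : largestPart π ≤ m.sum) : largestPart (mergeParts π m) = m.sum := by
  rw [largestPart, mergeParts_parts h hm, Multiset.sup_cons]
  exact sup_eq_left.2 ((Multiset.sup_mono
    (Multiset.subset_of_le (Multiset.sub_le_self _ _))).trans hL)

/-- The part sizes below `L - 1`, provided that `L - 1` is itself a part. -/
def lowerParts {n : ℕ} (π : n.Partition) : Finset ℕ :=
  if largestPart π - 1 ∈ π.parts then
    π.parts.toFinset.filter (· < largestPart π - 1)
  else ∅

theorem mem_lowerParts {n : ℕ} {π : n.Partition} {v : ℕ} :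
    v ∈ lowerParts π ↔
      largestPart π - 1 ∈ π.parts ∧ v ∈ π.parts ∧ v < largestPart π - 1 := by
  unfold lowerParts
  split_ifs with h <;> simp [h]

theorem pair_le_parts {n : ℕ} {π : n.Partition} {v : ℕ} (hv : v ∈ lowerParts π) :
    ({largestPart π - 1, v} : Multiset ℕ) ≤ π.parts := by
  obtain ⟨h1, h2, h3⟩ := mem_lowerParts.1 hv
  refine (Multiset.le_iff_subset (by simp [h3.ne'])).2 fun x hx => ?_
  rcases (by simpa using hx : x = largestPart π - 1 ∨ x = v) with rfl | rfl <;> assumption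

theorem sup_parts_sub_pair {n : ℕ} {π : n.Partition} {v : ℕ} (hv : v ∈ lowerParts π) :
    (π.parts - {largestPart π - 1, v}).sup = largestPart π := by
  obtain ⟨h1, h2, h3⟩ := mem_lowerParts.1 hv
  refine le_antisymm (Multiset.sup_mono
    (Multiset.subset_of_le (Multiset.sub_le_self _ _))) (Multiset.le_sup ?_)
  have h := Multiset.add_sub_cancel (pair_le_parts hv)
  have hL := largestPart_mem π (by omega)
  rw [← h, Multiset.mem_add] at hL
  refine hL.resolve_right fun hL => ?_
  simp at hL
  omega

theorem sum_card_lowerParts_le (n : ℕ) :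
    ∑ π : n.Partition, #(lowerParts π) ≤ Fintype.card n.Partition := by
  rw [← Finset.card_sigma, ← Finset.card_univ]
  refine Finset.card_le_card_of_injOn
    (fun x => mergeParts x.1 {largestPart x.1 - 1, x.2}) (by simp) ?_
  rintro ⟨π, v⟩ hπ ⟨ρ, w⟩ hρ h
  replace hπ : v ∈ lowerParts π := by simpa using hπ
  replace hρ : w ∈ lowerParts ρ := by simpa using hρ
  replace h : mergeParts π {largestPart π - 1, v} = mergeParts ρ {largestPart ρ - 1, w} := h
  have pos : ∀ {σ : n.Partition} {u : ℕ}, u ∈ lowerParts σ →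
      0 < ({largestPart σ - 1, u} : Multiset ℕ).sum ∧
      largestPart σ ≤ ({largestPart σ - 1, u} : Multiset ℕ).sum := by
    intro σ u hu
    obtain ⟨_, h2, h3⟩ := mem_lowerParts.1 hu
    have := σ.parts_pos h2
    simp only [Multiset.insert_eq_cons, Multiset.sum_cons, Multiset.sum_singleton]
    omega
  have hsum := congrArg largestPart h
  rw [largestPart_mergeParts (pair_le_parts hπ) (pos hπ).1 (pos hπ).2,
    largestPart_mergeParts (pair_le_parts hρ) (pos hρ).1 (pos hρ).2] at hsum
  have hparts := congrArg Nat.Partition.parts h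
  rw [mergeParts_parts (pair_le_parts hπ) (pos hπ).1,
    mergeParts_parts (pair_le_parts hρ) (pos hρ).1, hsum, Multiset.cons_inj_right] at hparts
  have hL : largestPart π = largestPart ρ := by
    rw [← sup_parts_sub_pair hπ, hparts, sup_parts_sub_pair hρ]
  have hvw : v = w := by simpa [hL] using hsum
  have hπρ : π = ρ := by
    apply Nat.Partition.ext
    rw [← Multiset.sub_add_cancel (pair_le_parts hπ), hparts, hL, hvw,
      Multiset.sub_add_cancel (pair_le_parts hρ)]
  rw [hπρ, hvw]

theorem maex_le_largestPart {n : ℕ} (π : n.Partition) : maex π ≤ largestPart π :=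
  (Nat.findGreatest_le _).trans (Nat.sub_le _ _)

theorem largestPart_le_maex_add {n : ℕ} (π : n.Partition) :
    largestPart π ≤ maex π + 2 + #(lowerParts π) := by
  by_cases h : largestPart π - 1 ∈ π.parts
  · have hsub : Finset.Ioo (maex π) (largestPart π - 1) ⊆ lowerParts π := by
      intro v hv
      obtain ⟨h1, h2⟩ := Finset.mem_Ioo.1 hv
      exact mem_lowerParts.2 ⟨h, not_not.1 (Nat.findGreatest_is_greatest h1 h2.le), h2⟩
    have := Finset.card_le_card hsub
    rw [Nat.card_Ioo] at this
    omega
  · have : largestPart π - 1 ≤ maex π :=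
      Nat.le_findGreatest (P := fun j => j ∉ π.parts) le_rfl h
    omega

theorem sigmaMaex_le_sigmaL (n : ℕ) : sigmaMaex n ≤ sigmaL n :=
  Finset.sum_le_sum fun π _ => maex_le_largestPart π

theorem sigmaL_le_sigmaMaex_add (n : ℕ) :
    sigmaL n ≤ sigmaMaex n + 3 * Fintype.card n.Partition := by
  have h : sigmaL n ≤ ∑ π : n.Partition, (maex π + 2 + #(lowerParts π)) :=
    Finset.sum_le_sum fun π _ => largestPart_le_maex_add π
  rw [Finset.sum_add_distrib, Finset.sum_add_distrib, Finset.sum_const, Finset.card_univ,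
    smul_eq_mul] at h
  have := sum_card_lowerParts_le n
  unfold sigmaMaex
  omega

/-- A partition of a large number into bounded parts has a part of large multiplicity. -/
theorem exists_le_count {n K T : ℕ} (hn : K * (K * T) < n) (π : n.Partition)
    (hπ : largestPart π ≤ K) : ∃ v, 0 < v ∧ v ≤ K ∧ T ≤ π.parts.count v := by
  by_contra! hcon
  refine hn.not_ge ?_
  have hsub : π.parts.toFinset ⊆ Finset.Icc 1 K := by
    intro v hv
    rw [Multiset.mem_toFinset] at hv
    exact Finset.mem_Icc.2 ⟨π.parts_pos hv, (le_largestPart π hv).trans hπ⟩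
  calc n = ∑ v ∈ π.parts.toFinset, π.parts.count v * v := by
        simpa [π.parts_sum] using Finset.sum_multiset_count π.parts
    _ ≤ ∑ v ∈ Finset.Icc 1 K, π.parts.count v * v :=
        Finset.sum_le_sum_of_subset hsub
    _ ≤ ∑ v ∈ Finset.Icc 1 K, K * T := by
        refine Finset.sum_le_sum fun v hv => ?_
        obtain ⟨h1, h2⟩ := Finset.mem_Icc.1 hv
        rw [mul_comm]
        exact Nat.mul_le_mul h2 (hcon v h1 h2).le
    _ = K * (K * T) := by simp

theorem mul_card_largestPart_le {n K N : ℕ} (hn : K * (K * (K + N)) < n) :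
    #{π : n.Partition | largestPart π ≤ K} * N ≤ Fintype.card n.Partition * K := by
  choose! f hf using exists_le_count hn
  have hle : ∀ {π : n.Partition} {j : ℕ}, largestPart π ≤ K → j ≤ K + N →
      Multiset.replicate j (f π) ≤ π.parts := fun hπ hj =>
    Multiset.le_count_iff_replicate_le.1 (hj.trans (hf _ hπ).2.2)
  have hlt : ∀ {π : n.Partition} {j : ℕ}, largestPart π ≤ K → K < j →
      K < (Multiset.replicate j (f π)).sum := fun hπ hj => by
    rw [Multiset.sum_replicate, smul_eq_mul]
    exact hj.trans_le (Nat.le_mul_of_pos_right _ (hf _ hπ).1)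
  have key : #(({π : n.Partition | largestPart π ≤ K} : Finset n.Partition) ×ˢ Finset.Ioc K (K + N)) ≤
      #((Finset.univ : Finset n.Partition) ×ˢ Finset.Icc 1 K) := by
    refine Finset.card_le_card_of_injOn
      (fun x => (mergeParts x.1 (Multiset.replicate x.2 (f x.1)), f x.1)) ?_ ?_
    · rintro ⟨π, j⟩ hx
      have hπ : largestPart π ≤ K := by simp at hx; exact hx.1
      simpa using ⟨(hf π hπ).1, (hf π hπ).2.1⟩
    · rintro ⟨π, i⟩ hx ⟨ρ, j⟩ hy h
      simp only [Finset.coe_product, Set.mem_prod, Finset.mem_coe, Finset.mem_filter,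
        Finset.mem_univ, true_and, Finset.mem_Ioc] at hx hy
      obtain ⟨hπ, hi, hi'⟩ := hx
      obtain ⟨hρ, hj, hj'⟩ := hy
      obtain ⟨h, hv⟩ := Prod.mk.inj h
      dsimp only at h hv
      have hsum := congrArg largestPart h
      rw [largestPart_mergeParts (hle hπ hi') (Nat.zero_lt_of_lt (hlt hπ hi))
          (hπ.trans (hlt hπ hi).le),
        largestPart_mergeParts (hle hρ hj') (Nat.zero_lt_of_lt (hlt hρ hj))
          (hρ.trans (hlt hρ hj).le)] at hsum
      have hparts := congrArg Nat.Partition.parts h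
      rw [mergeParts_parts (hle hπ hi') (Nat.zero_lt_of_lt (hlt hπ hi)),
        mergeParts_parts (hle hρ hj') (Nat.zero_lt_of_lt (hlt hρ hj)), hsum,
        Multiset.cons_inj_right] at hparts
      have hij : i = j := by
        rw [Multiset.sum_replicate, Multiset.sum_replicate, hv, smul_eq_mul, smul_eq_mul] at hsum
        exact Nat.eq_of_mul_eq_mul_right (hf ρ hρ).1 hsum
      have hπρ : π = ρ := by
        apply Nat.Partition.ext
        rw [← Multiset.sub_add_cancel (hle hπ hi'), hparts, hv, hij,
          Multiset.sub_add_cancel (hle hρ hj')]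
      rw [hπρ, hij]
  simpa [Finset.card_product] using key

/-- The average largest part of the partitions of `n` tends to infinity. -/
theorem eventually_mul_card_le_sigmaL (K : ℕ) :
    ∀ᶠ n : ℕ in atTop, K * Fintype.card n.Partition ≤ 2 * sigmaL n := by
  filter_upwards [eventually_gt_atTop (K * (K * (K + 2 * K)))] with n hn
  rcases Nat.eq_zero_or_pos K with rfl | hK
  · simp
  have hsmall := mul_card_largestPart_le hn
  have hhalf : 2 * #{π : n.Partition | largestPart π ≤ K} ≤ Fintype.card n.Partition := by
    refine Nat.le_of_mul_le_mul_right ?_ hK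
    linarith
  have hsplit := Finset.card_filter_add_card_filter_not (s := (Finset.univ : Finset n.Partition))
    (fun π => largestPart π ≤ K)
  rw [Finset.card_univ] at hsplit
  have hlarge : #{π : n.Partition | ¬ largestPart π ≤ K} * K ≤ sigmaL n := by
    rw [← smul_eq_mul]
    refine (Finset.card_nsmul_le_sum _ _ K fun π hπ => ?_).trans
      (Finset.sum_le_sum_of_subset (Finset.filter_subset _ _))
    exact (not_le.1 (Finset.mem_filter.1 hπ).2).le
  calc K * Fintype.card n.Partition
      ≤ K * (2 * #{π : n.Partition | ¬ largestPart π ≤ K}) :=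
        Nat.mul_le_mul_left _ (by omega)
    _ ≤ 2 * sigmaL n := by linarith

/-- As `n → ∞`, `σmaex(n) ∼ σL(n)`, i.e. `σmaex(n)/σL(n) → 1`. -/
theorem sigmaMaex_asymptotic_sigmaL :
    Tendsto (fun n : ℕ => (sigmaMaex n : ℝ) / (sigmaL n : ℝ)) atTop (nhds 1) := by
  refine tendsto_order.2 ⟨fun a ha => ?_, fun a ha => ?_⟩
  · obtain ⟨K, hK⟩ := exists_nat_gt (6 / (1 - a))
    filter_upwards [eventually_mul_card_le_sigmaL (K + 1)] with n hn
    have hP : (0 : ℝ) < Fintype.card n.Partition := by exact_mod_cast Fintype.card_pos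
    have hn' : ((K : ℝ) + 1) * Fintype.card n.Partition ≤ 2 * sigmaL n := by exact_mod_cast hn
    have hsub : (sigmaL n : ℝ) ≤ sigmaMaex n + 3 * Fintype.card n.Partition := by
      exact_mod_cast sigmaL_le_sigmaMaex_add n
    have hS : (0 : ℝ) < sigmaL n := by
      have : 0 < ((K : ℝ) + 1) * Fintype.card n.Partition := by positivity
      linarith
    rw [div_lt_iff₀ (by linarith)] at hK
    rw [lt_div_iff₀ hS]
    have h1 : 6 * (Fintype.card n.Partition : ℝ) <
        K * (1 - a) * Fintype.card n.Partition := by gcongr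
    have h2 := mul_le_mul_of_nonneg_left hn' (by linarith : 0 ≤ 1 - a)
    have h3 : 0 < (1 - a) * (Fintype.card n.Partition : ℝ) := mul_pos (by linarith) hP
    linarith
  · refine Eventually.of_forall fun n => lt_of_le_of_lt ?_ ha
    exact div_le_one_of_le₀ (by exact_mod_cast sigmaMaex_le_sigmaL n) (Nat.cast_nonneg _)
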